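/- arXiv:2012.01011 — 2 statements merged into one kernel-verified Lean document; each statement's English description precedes it below -/
import Mathlib

section
/- Termination of FAM's fairness step: in each sub-step of Step 2 of a FAM mechanism, a higher-priority student replaces a lower-priority student at some school while the number of assigned students is preserved; since students and schools are finite and the multiset of priority ranks of students assigned to schools lexicographically improves, the process of resolving violations of fairness for unassigned students terminates in finitely many rounds. -/
open Finset
open scoped Classical

/-- A matching assigns each student a school or `none` (unassigned). -/
abbrev Matching (I S : Type*) := I → Option S

/-- An individual strict preference over `S ∪ {∅}`: an injective utility
function on `Option S` (higher value = more preferred, `none` = being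
unassigned). -/
abbrev IndPref (S : Type*) := {f : Option S → ℕ // Function.Injective f}

/-- A preference profile: one strict preference per student. -/
abbrev Prof (I S : Type*) := I → IndPref S

/-- Strict school priorities: for each school, an injective rank over
students (higher value = higher priority). -/
abbrev Prio (I S : Type*) := {p : S → I → ℕ // ∀ s, Function.Injective (p s)}

/-- A mechanism maps reported preference profiles to matchings. -/
abbrev Mechanism (I S : Type*) := Prof I S → Matching I S

variable {I S : Type*} [Fintype I] [DecidableEq I] [Fintype S] [DecidableEq S]

/-- Capacity feasibility. -/
def Feasible (q : S → ℕ) (μ : Matching I S) : Prop :=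
  ∀ s : S, (univ.filter fun i => μ i = some s).card ≤ q s

/-- Individual rationality with respect to profile `P`. -/
def IndivRational (P : Prof I S) (μ : Matching I S) : Prop :=
  ∀ i, (P i).1 none ≤ (P i).1 (μ i)

/-- Number of assigned students. -/
def msize (μ : Matching I S) : ℕ := (univ.filter fun i => μ i ≠ none).card

/-- Maximality: no feasible individually rational matching assigns strictly
more students. -/
def MaximalMatching (P : Prof I S) (q : S → ℕ) (μ : Matching I S) : Prop :=
  ∀ μ' : Matching I S, Feasible q μ' → IndivRational P μ' → msize μ' ≤ msize μ

/-- `μ'` Pareto dominates `μ`. -/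
def Dominates (P : Prof I S) (μ' μ : Matching I S) : Prop :=
  (∀ i, (P i).1 (μ i) ≤ (P i).1 (μ' i)) ∧ ∃ j, (P j).1 (μ j) < (P j).1 (μ' j)

/-- Pareto efficiency among feasible individually rational matchings. -/
def Efficient (P : Prof I S) (q : S → ℕ) (μ : Matching I S) : Prop :=
  ¬ ∃ μ', Feasible q μ' ∧ IndivRational P μ' ∧ Dominates P μ' μ

/-- Non-wastefulness. -/
def NonWasteful (P : Prof I S) (q : S → ℕ) (μ : Matching I S) : Prop :=
  ∀ i s, (P i).1 (μ i) < (P i).1 (some s) →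
    (univ.filter fun j => μ j = some s).card = q s

/-- Fairness (no justified envy). -/
def Fair (P : Prof I S) (pr : Prio I S) (μ : Matching I S) : Prop :=
  ¬ ∃ i s j, (P i).1 (μ i) < (P i).1 (some s) ∧ μ j = some s ∧ pr.1 s j < pr.1 s i

/-- Stability: individually rational, non-wasteful and fair. -/
def Stable (P : Prof I S) (pr : Prio I S) (q : S → ℕ) (μ : Matching I S) : Prop :=
  Feasible q μ ∧ IndivRational P μ ∧ NonWasteful P q μ ∧ Fair P pr μ

/-- Fairness for unassigned students. -/
def FairForUnassigned (P : Prof I S) (pr : Prio I S) (μ : Matching I S) : Prop :=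
  ¬ ∃ i s j, μ i = none ∧ (P i).1 none < (P i).1 (some s) ∧ μ j = some s ∧
    pr.1 s j < pr.1 s i

/-- `(a, t)` is an improving chain for `μ`: each student `a k` strictly
prefers `t k` to their assignment, each school `t k` (for `k < n`) is
currently occupied by the next student `a (k+1)`, and the last school has
excess capacity. -/
def IsImpChain (P : Prof I S) (q : S → ℕ) (μ : Matching I S)
    (n : ℕ) (a : Fin (n + 1) → I) (t : Fin (n + 1) → S) : Prop :=
  Function.Injective a ∧
  (∀ k, (P (a k)).1 (μ (a k)) < (P (a k)).1 (some (t k))) ∧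
  (∀ k : Fin n, μ (a k.succ) = some (t k.castSucc)) ∧
  (univ.filter fun j => μ j = some (t (Fin.last n))).card < q (t (Fin.last n))

/-- `(a, t)` is an improving cycle for `μ`: each student `a k` is assigned
to `t k` and strictly prefers the school `t (k+1)` vacated by the next
student in the cycle. -/
def IsImpCycle (P : Prof I S) (μ : Matching I S)
    (n : ℕ) (a : Fin (n + 1) → I) (t : Fin (n + 1) → S) : Prop :=
  Function.Injective a ∧
  (∀ k, μ (a k) = some (t k)) ∧
  (∀ k, (P (a k)).1 (some (t k)) < (P (a k)).1 (some (t (k + 1))))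

def HasImpChain (P : Prof I S) (q : S → ℕ) (μ : Matching I S) : Prop :=
  ∃ n a t, IsImpChain P q μ n a t

def HasImpCycle (P : Prof I S) (μ : Matching I S) : Prop :=
  ∃ n a t, IsImpCycle P μ n a t

/-- Implementing one improving chain or cycle: every student involved moves
to the school they prefer in the chain/cycle, all others keep their
assignment. -/
def ImplementStep (P : Prof I S) (q : S → ℕ) (μ μ' : Matching I S) : Prop :=
  (∃ n a t, IsImpChain P q μ n a t ∧ (∀ k, μ' (a k) = some (t k)) ∧
    ∀ j, (∀ k, j ≠ a k) → μ' j = μ j) ∨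
  (∃ n a t, IsImpCycle P μ n a t ∧ (∀ k, μ' (a k) = some (t (k + 1))) ∧
    ∀ j, (∀ k, j ≠ a k) → μ' j = μ j)

/-- One refinement step of the first stage of EAM: keep only the matchings
assigning student `i`, whenever such matchings exist. -/
noncomputable def xiStep (A : Set (Matching I S)) (i : I) : Set (Matching I S) :=
  if ∃ μ ∈ A, μ i ≠ none then {μ ∈ A | μ i ≠ none} else A

/-- The set `ξ^n` of the first stage of EAM, for the enumeration `L` of the
students, starting from all feasible individually rational matchings. -/
noncomputable def xiList (P : Prof I S) (q : S → ℕ) (L : List I) :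
    Set (Matching I S) :=
  L.foldl xiStep {μ | Feasible q μ ∧ IndivRational P μ}

/-- `μ` is a possible outcome of an EAM procedure with student enumeration
`L`: it is reachable from some matching selected in the first stage by
implementing improving chains/cycles, and admits no further improving chain
or cycle. -/
def IsEAMOutcome (P : Prof I S) (q : S → ℕ) (L : List I) (μ : Matching I S) :
    Prop :=
  ∃ μ₀ ∈ xiList P q L, Relation.ReflTransGen (ImplementStep P q) μ₀ μ ∧
    ¬ HasImpChain P q μ ∧ ¬ HasImpCycle P μ

/-- EAM mechanisms with enumeration `L`. -/
def IsEAMMech (q : S → ℕ) (L : List I) (ψ : Mechanism I S) : Prop :=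
  ∀ P, IsEAMOutcome P q L (ψ P)

/-- One sub-step of Step 2 of FAM: a pair `(i, s)` violating fairness for
unassigned students is resolved by placing `i` at `s` and unassigning the
lowest-priority student currently matched to `s`. -/
def FairStep (P : Prof I S) (pr : Prio I S) (μ μ' : Matching I S) : Prop :=
  ∃ i s j, μ i = none ∧ (P i).1 none < (P i).1 (some s) ∧ μ j = some s ∧
    pr.1 s j < pr.1 s i ∧ (∀ j', μ j' = some s → pr.1 s j ≤ pr.1 s j') ∧
    μ' = Function.update (Function.update μ j none) i (some s)

/-- FAM mechanisms: an EAM first stage followed by iterated resolution of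
violations of fairness for unassigned students. -/
def IsFAMMech (q : S → ℕ) (pr : Prio I S) (L : List I) (ψ : Mechanism I S) :
    Prop :=
  ∀ P, ∃ μ₁, IsEAMOutcome P q L μ₁ ∧
    Relation.ReflTransGen (FairStep P pr) μ₁ (ψ P) ∧
    FairForUnassigned P pr (ψ P)

/-- Individually rational mechanism (with respect to reports). -/
def IRMech (q : S → ℕ) (ψ : Mechanism I S) : Prop :=
  ∀ P, Feasible q (ψ P) ∧ IndivRational P (ψ P)

/-- MaximalMatching mechanism. -/
def MaximalMech (q : S → ℕ) (ψ : Mechanism I S) : Prop :=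
  IRMech q ψ ∧ ∀ P, MaximalMatching P q (ψ P)

/-- Nash equilibrium of the preference-reporting game induced by `ψ`, with
true preferences `u`. -/
def NashEq (u : Prof I S) (ψ : Mechanism I S) (P' : Prof I S) : Prop :=
  ∀ (i : I) (Pi'' : IndPref S),
    (u i).1 (ψ (Function.update P' i Pi'') i) ≤ (u i).1 (ψ P' i)

/-- Strategy-proofness. -/
def StrategyProof (ψ : Mechanism I S) : Prop :=
  ∀ (P : Prof I S) (i : I) (Pi' : IndPref S),
    (P i).1 (ψ (Function.update P i Pi') i) ≤ (P i).1 (ψ P i)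

/-- A maximizer of `f` on the nonempty finite set `A`. -/
noncomputable def bestOf (f : Option S → ℕ) (A : Finset (Option S))
    (h : A.Nonempty) : Option S :=
  (Finset.exists_max_image A f h).choose

/-- Serial dictatorship: students pick, in the order given, their most
preferred option among `none` and the schools with remaining capacity. -/
noncomputable def sdRun (P : Prof I S) :
    List I → (S → ℕ) → Matching I S → Matching I S
  | [], _, μ => μ
  | i :: rest, rem, μ =>
    let c := bestOf (P i).1 (insert none ((univ.filter fun s => 0 < rem s).image some))
      (insert_nonempty _ _)
    sdRun P rest (fun s => if c = some s then rem s - 1 else rem s)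
      (Function.update μ i c)

/-- The serial dictatorship outcome with ordering `L` and capacities `q`. -/
noncomputable def SD (P : Prof I S) (q : S → ℕ) (L : List I) : Matching I S :=
  sdRun P L q fun _ => none


variable {I S : Type*} [Fintype I] [DecidableEq I] [Fintype S] [DecidableEq S]

/-- termination of Step 2 of FAM: there is no infinite sequence
of fairness-restoring sub-steps starting from a maximal individually
rational matching. -/
theorem FAM_fairness_step_terminates
    (P : Prof I S) (pr : Prio I S) (q : S → ℕ) (μ₀ : Matching I S)
    (hF : Feasible q μ₀) (hIR : IndivRational P μ₀)
    (hMax : MaximalMatching P q μ₀) :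
    ¬ ∃ f : ℕ → Matching I S, f 0 = μ₀ ∧
      ∀ n : ℕ, FairStep P pr (f n) (f (n + 1)) := by
  rintro ⟨f, -, hf⟩
  let g : I → Option S → ℕ := fun i o => o.elim 0 (fun s => pr.1 s i)
  let Φ : Matching I S → ℕ := fun μ => ∑ i, g i (μ i)
  have hlt : ∀ n, Φ (f n) < Φ (f (n + 1)) := by
    intro n
    obtain ⟨i, s, j, hi, -, hj, hp, -, hu⟩ := hf n
    have hij : i ≠ j := by
      rintro rfl
      rw [hi] at hj
      cases hj
    have hsplit : ∀ μ : Matching I S,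
        Φ μ = g i (μ i) + (g j (μ j) + ∑ k ∈ (univ.erase i).erase j, g k (μ k)) := by
      intro μ
      have hm : j ∈ (univ : Finset I).erase i := by simp [hij.symm]
      rw [Finset.add_sum_erase _ (fun k => g k (μ k)) hm,
        Finset.add_sum_erase _ (fun k => g k (μ k)) (mem_univ i)]
    have hrest : ∑ k ∈ (univ.erase i).erase j, g k (f (n + 1) k)
        = ∑ k ∈ (univ.erase i).erase j, g k (f n k) := by
      refine Finset.sum_congr rfl fun k hk => ?_
      simp only [mem_erase, mem_univ, and_true] at hk
      rw [hu, Function.update_of_ne hk.2, Function.update_of_ne hk.1]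
    have hi' : f (n + 1) i = some s := by rw [hu, Function.update_self]
    have hj' : f (n + 1) j = none := by
      rw [hu, Function.update_of_ne hij.symm, Function.update_self]
    rw [hsplit (f n), hsplit (f (n + 1)), hrest, hi, hj, hi', hj']
    simp only [g, Option.elim]
    omega
  have hmono : StrictMono (fun n => Φ (f n)) := strictMono_nat_of_lt_succ hlt
  have hinj : Function.Injective f := fun a b hab =>
    hmono.injective (congrArg Φ hab)
  exact not_injective_infinite_finite f hinj
end

section
/- In any market, no EAM mechanism is size-wise dominated in equilibrium by an individually rational mechanism: there is no individually rational mechanism φ such that for every preference profile P and all Nash equilibria P', P'' of the EAM mechanism ψ and φ respectively, |ψ(P')| ≤ |φ(P'')| holds, with strict inequality at some profile for all equilibria. -/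
open Finset
open scoped Classical

variable {I S : Type*} [Fintype I] [DecidableEq I] [Fintype S] [DecidableEq S]

variable {I S : Type*} [Fintype I] [DecidableEq I] [Fintype S] [DecidableEq S]

/-- Re-tiered preference: compare first by tier, then by the original utility. -/
noncomputable def tiered (f : IndPref S) (T : Option S → ℕ) : IndPref S :=
  ⟨fun x => T x * (univ.sup f.1 + 1) + f.1 x, by
    intro x y h
    have hx : f.1 x ≤ univ.sup f.1 := le_sup (f := f.1) (mem_univ x)
    have hy : f.1 y ≤ univ.sup f.1 := le_sup (f := f.1) (mem_univ y)
    apply f.2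
    have h2 := congrArg (fun z => z % (univ.sup f.1 + 1)) h
    simp only [Nat.mul_add_mod_self_right] at h2
    rwa [Nat.mod_eq_of_lt (by omega), Nat.mod_eq_of_lt (by omega)] at h2⟩

lemma tiered_le_iff (f : IndPref S) (T : Option S → ℕ) (x y : Option S) :
    (tiered f T).1 x ≤ (tiered f T).1 y ↔ T x < T y ∨ (T x = T y ∧ f.1 x ≤ f.1 y) := by
  have hx : f.1 x ≤ univ.sup f.1 := le_sup (f := f.1) (mem_univ x)
  have hy : f.1 y ≤ univ.sup f.1 := le_sup (f := f.1) (mem_univ y)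
  change T x * (univ.sup f.1 + 1) + f.1 x ≤ T y * (univ.sup f.1 + 1) + f.1 y ↔ _
  generalize univ.sup f.1 = M at *
  rcases lt_trichotomy (T x) (T y) with h | h | h
  · have : (T x + 1) * (M + 1) ≤ T y * (M + 1) := Nat.mul_le_mul_right _ h
    simp only [h, true_or, iff_true]
    nlinarith
  · simp [h]
  · have : (T y + 1) * (M + 1) ≤ T x * (M + 1) := Nat.mul_le_mul_right _ h
    constructor
    · intro h'
      exfalso
      nlinarith
    · rintro (h' | h') <;> omega

/-- Report declaring only the option `c` (and `none`) acceptable. -/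
noncomputable def onlyPref (f : IndPref S) (c : Option S) : IndPref S :=
  tiered f fun x => if x = c then 2 else if x = none then 1 else 0

lemma onlyPref_ir (f : IndPref S) (c x : Option S)
    (h : (onlyPref f c).1 none ≤ (onlyPref f c).1 x) : x = c ∨ x = none := by
  unfold onlyPref at h
  rw [tiered_le_iff] at h
  by_contra hc
  push Not at hc
  simp only [hc.1, hc.2, if_false] at h
  by_cases h0 : none = c
  · simp [h0] at h
  · simp [h0] at h

lemma onlyPref_le (f : IndPref S) (c : Option S) :
    (onlyPref f c).1 none ≤ (onlyPref f c).1 c := by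
  unfold onlyPref
  rw [tiered_le_iff]
  by_cases h : none = c
  · simp [h]
  · simp [h]

/-- Feasible and IR. -/
def FIR (P : Prof I S) (q : S → ℕ) : Set (Matching I S) :=
  {μ | Feasible q μ ∧ IndivRational P μ}

lemma xi_snoc (P : Prof I S) (q : S → ℕ) (A : List I) (k : I) :
    xiList P q (A ++ [k]) = xiStep (xiList P q A) k := by
  simp [xiList, List.foldl_append]

lemma xiStep_sub (X : Set (Matching I S)) (k : I) : xiStep X k ⊆ X := by
  unfold xiStep
  split_ifs
  · exact fun _ h => h.1
  · exact subset_rfl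

lemma xi_append_sub (P : Prof I S) (q : S → ℕ) (A B : List I) :
    xiList P q (A ++ B) ⊆ xiList P q A := by
  induction B using List.reverseRecOn with
  | nil => simp
  | append_singleton B k ih =>
    rw [← List.append_assoc, xi_snoc]
    exact (xiStep_sub _ _).trans ih

lemma xi_sub_FIR (P : Prof I S) (q : S → ℕ) (A : List I) : xiList P q A ⊆ FIR P q := by
  have := xi_append_sub P q [] A
  simpa [xiList, FIR] using this

lemma xiStep_mem (X : Set (Matching I S)) (k : I) (μ : Matching I S) :
    μ ∈ xiStep X k ↔ μ ∈ X ∧ ((∃ ρ ∈ X, ρ k ≠ none) → μ k ≠ none) := by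
  unfold xiStep
  split_ifs with h
  · exact ⟨fun h' => ⟨h'.1, fun _ => h'.2⟩, fun h' => ⟨h'.1, h'.2 h⟩⟩
  · exact ⟨fun h' => ⟨h', fun h2 => absurd h2 h⟩, fun h' => h'.1⟩

lemma xi_same (P : Prof I S) (q : S → ℕ) (A : List I) :
    ∀ μ ∈ xiList P q A, ∀ ρ ∈ xiList P q A, ∀ k ∈ A, (μ k ≠ none ↔ ρ k ≠ none) := by
  induction A using List.reverseRecOn with
  | nil => simp
  | append_singleton A k ih =>
    intro μ hμ ρ hρ j hj
    rw [xi_snoc, xiStep_mem] at hμ hρ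
    rcases List.mem_append.1 hj with hj | hj
    · exact ih μ hμ.1 ρ hρ.1 j hj
    · rw [List.mem_singleton] at hj
      subst hj
      exact ⟨fun h => hρ.2 ⟨μ, hμ.1, h⟩, fun h => hμ.2 ⟨ρ, hρ.1, h⟩⟩

lemma xi_up (P : Prof I S) (q : S → ℕ) (ν₀ ν : Matching I S) (hν : ν ∈ FIR P q)
    (hsub : ∀ i, ν₀ i ≠ none → ν i ≠ none) (A : List I) (h0 : ν₀ ∈ xiList P q A) :
    ν ∈ xiList P q A := by
  induction A using List.reverseRecOn with
  | nil => simpa [xiList, FIR] using hν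
  | append_singleton A k ih =>
    rw [xi_snoc, xiStep_mem] at h0 ⊢
    exact ⟨ih h0.1, fun h => hsub k (h0.2 h)⟩

lemma feasible_mono (q : S → ℕ) (μ μ' : Matching I S) (h : Feasible q μ)
    (hs : ∀ i s, μ' i = some s → μ i = some s) : Feasible q μ' := by
  intro s
  refine le_trans (card_le_card ?_) (h s)
  intro i
  simp only [mem_filter, mem_univ, true_and]
  exact hs i s

lemma xi_transfer (q : S → ℕ) (A : List I) :
    ∀ (P P' : Prof I S), (∀ k ∈ A, P k = P' k) → ∀ ν ∈ xiList P q A, ∀ m ∈ FIR P' q,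
      (∀ k ∈ A, (m k ≠ none ↔ ν k ≠ none)) → m ∈ xiList P' q A := by
  induction A using List.reverseRecOn with
  | nil =>
    intro P P' _ ν _ m hm _
    simpa [xiList, FIR] using hm
  | append_singleton A k ih =>
    intro P P' hP ν hν m hm hmν
    rw [xi_snoc, xiStep_mem] at hν ⊢
    have hPA : ∀ k ∈ A, P k = P' k := fun j hj => hP j (by simp [hj])
    have hA : ∀ k ∈ A, (m k ≠ none ↔ ν k ≠ none) := fun j hj => hmν j (by simp [hj])
    have hmA := ih P P' hPA ν hν.1 m hm hA
    refine ⟨hmA, ?_⟩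
    rintro ⟨ρ, hρ, hρk⟩
    have hρF := xi_sub_FIR _ _ _ hρ
    rw [hmν k (by simp)]
    apply hν.2
    refine ⟨fun j => if j ∈ A ++ [k] then ρ j else none, ?_, by simpa using hρk⟩
    refine ih P' P (fun j hj => (hPA j hj).symm) ρ hρ _ ⟨?_, ?_⟩ ?_
    · refine feasible_mono q ρ _ hρF.1 ?_
      intro i s h
      by_cases hi : i ∈ A ++ [k]
      · rwa [if_pos hi] at h
      · rw [if_neg hi] at h
        cases h
    · intro i
      by_cases hi : i ∈ A ++ [k]
      · simp only [if_pos hi]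
        rw [hP i hi]
        exact hρF.2 i
      · simp only [if_neg hi]
        exact le_rfl
    · intro j hj
      simp [hj]
    -- restricted matching is available under the other profile

lemma count_split (μ : Matching I S) (n : ℕ) (a : Fin (n + 1) → I)
    (ha : Function.Injective a) (s : S) :
    (univ.filter fun j => μ j = some s).card =
      (univ.filter fun j => (∀ k, j ≠ a k) ∧ μ j = some s).card +
        ∑ k, if μ (a k) = some s then 1 else 0 := by
  have h1 : (univ.filter fun j => μ j = some s) =
      (univ.filter fun j => (∀ k, j ≠ a k) ∧ μ j = some s) ∪
        ((univ.filter fun k => μ (a k) = some s).image a) := by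
    ext j
    simp only [mem_filter, mem_univ, true_and, mem_union, mem_image]
    constructor
    · intro h
      by_cases hj : ∀ k, j ≠ a k
      · exact Or.inl ⟨hj, h⟩
      · push Not at hj
        obtain ⟨k, rfl⟩ := hj
        exact Or.inr ⟨k, h, rfl⟩
    · rintro (h | ⟨k, h, rfl⟩)
      · exact h.2
      · exact h
  rw [h1, card_union_of_disjoint, card_image_of_injective _ ha,
    card_filter (fun k => μ (a k) = some s)]
  rw [Finset.disjoint_left]
  intro j hj hj'
  simp only [mem_filter, mem_univ, true_and, mem_image] at hj hj'
  obtain ⟨k, _, rfl⟩ := hj'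
  exact hj.1 k rfl

lemma step_ok (P : Prof I S) (q : S → ℕ) (μ μ' : Matching I S) (hμ : μ ∈ FIR P q)
    (h : ImplementStep P q μ μ') :
    μ' ∈ FIR P q ∧ ∀ i, μ i ≠ none → μ' i ≠ none := by
  have key : ∀ (n : ℕ) (a : Fin (n + 1) → I), (∀ j, (∀ k, j ≠ a k) → μ' j = μ j) → ∀ s,
      (univ.filter fun j => (∀ k, j ≠ a k) ∧ μ' j = some s) =
      (univ.filter fun j => (∀ k, j ≠ a k) ∧ μ j = some s) := by
    intro n a ho s
    apply filter_congr
    intro j _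
    constructor
    · rintro ⟨h1, h2⟩
      exact ⟨h1, by rw [← ho j h1]; exact h2⟩
    · rintro ⟨h1, h2⟩
      exact ⟨h1, by rw [ho j h1]; exact h2⟩
  rcases h with ⟨n, a, t, ⟨ha, hp, hc, hl⟩, hm, ho⟩ | ⟨n, a, t, ⟨ha, hc, hp⟩, hm, ho⟩
  · refine ⟨⟨?_, ?_⟩, ?_⟩
    · intro s
      have e1 := count_split μ n a ha s
      have e2 := count_split μ' n a ha s
      rw [key n a ho s] at e2
      simp only [hm] at e2
      rw [Fin.sum_univ_castSucc] at e2
      rw [Fin.sum_univ_succ] at e1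
      simp only [hc] at e1
      have hf := hμ.1 s
      by_cases hs : t (Fin.last n) = s
      · rw [hs] at hl
        simp only [hs, if_true] at e2
        omega
      · rw [if_neg (by simpa using hs)] at e2
        omega
    · intro j
      by_cases hj : ∀ k, j ≠ a k
      · rw [ho j hj]
        exact hμ.2 j
      · push Not at hj
        obtain ⟨k, rfl⟩ := hj
        rw [hm k]
        exact (hμ.2 _).trans (hp k).le
    · intro j hj'
      by_cases hj : ∀ k, j ≠ a k
      · rwa [ho j hj]
      · push Not at hj
        obtain ⟨k, rfl⟩ := hj
        simp [hm k]
  · refine ⟨⟨?_, ?_⟩, ?_⟩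
    · intro s
      have e1 := count_split μ n a ha s
      have e2 := count_split μ' n a ha s
      rw [key n a ho s] at e2
      simp only [hm] at e2
      simp only [hc] at e1
      have e3 : (∑ k, if some (t (k + 1)) = some s then 1 else 0) =
          ∑ k, if some (t k) = some s then 1 else 0 :=
        Equiv.sum_comp (Equiv.addRight (1 : Fin (n + 1)))
          (fun k => if some (t k) = some s then 1 else 0)
      have hf := hμ.1 s
      omega
    · intro j
      by_cases hj : ∀ k, j ≠ a k
      · rw [ho j hj]
        exact hμ.2 j
      · push Not at hj
        obtain ⟨k, rfl⟩ := hj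
        rw [hm k]
        refine (hμ.2 _).trans ?_
        rw [hc k]
        exact (hp k).le
    · intro j hj'
      by_cases hj : ∀ k, j ≠ a k
      · rwa [ho j hj]
      · push Not at hj
        obtain ⟨k, rfl⟩ := hj
        simp [hm k]

lemma steps_ok (P : Prof I S) (q : S → ℕ) (μ μ' : Matching I S) (hμ : μ ∈ FIR P q)
    (h : Relation.ReflTransGen (ImplementStep P q) μ μ') :
    μ' ∈ FIR P q ∧ ∀ i, μ i ≠ none → μ' i ≠ none := by
  induction h with
  | refl => exact ⟨hμ, fun _ h => h⟩
  | tail _ hs ih =>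
    have := step_ok P q _ _ ih.1 hs
    exact ⟨this.1, fun i hi => this.2 i (ih.2 i hi)⟩

lemma eam_mem (P : Prof I S) (q : S → ℕ) (L : List I) (μ : Matching I S)
    (h : IsEAMOutcome P q L μ) : μ ∈ xiList P q L := by
  obtain ⟨μ₀, h0, hr, _⟩ := h
  have := steps_ok P q μ₀ μ (xi_sub_FIR _ _ _ h0) hr
  exact xi_up P q μ₀ μ this.1 this.2 L h0

/-- Declarative characterization of the serial dictatorship outcome. -/
def SDlike (u : Prof I S) (q : S → ℕ) (L : List I) (ν : Matching I S) : Prop :=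
  Feasible q ν ∧ IndivRational u ν ∧ ∀ A i B, L = A ++ i :: B → ∀ s,
    (univ.filter fun k => k ∈ A ∧ ν k = some s).card < q s →
      (u i).1 (some s) ≤ (u i).1 (ν i)

lemma nash_ir (u : Prof I S) (q : S → ℕ) (φ : Mechanism I S) (hφ : IRMech q φ)
    (P : Prof I S) (h : NashEq u φ P) : IndivRational u (φ P) := by
  intro i
  have h1 := h i (onlyPref (u i) none)
  have h2 := (hφ (Function.update P i (onlyPref (u i) none))).2 i
  rw [Function.update_self] at h2
  have h3 : φ (Function.update P i (onlyPref (u i) none)) i = none := by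
    simpa using onlyPref_ir _ _ _ h2
  rwa [h3] at h1

lemma nash_sdlike (u : Prof I S) (q : S → ℕ) (L : List I) (hnd : L.Nodup)
    (ψ : Mechanism I S) (hψ : IsEAMMech q L ψ) (P : Prof I S) (h : NashEq u ψ P) :
    SDlike u q L (ψ P) := by
  have hmem : ∀ P, ψ P ∈ xiList P q L := fun P => eam_mem P q L _ (hψ P)
  have hIR : IRMech q ψ := fun P => xi_sub_FIR _ _ _ (hmem P)
  refine ⟨(hIR P).1, nash_ir u q ψ hIR P h, ?_⟩
  intro A i B hL s hs
  have hiA : i ∉ A := by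
    intro hi
    rw [hL] at hnd
    exact (List.disjoint_of_nodup_append hnd) hi (by simp)
  set P' := Function.update P i (onlyPref (u i) (some s)) with hP'
  have hν : ψ P ∈ xiList P q A := by
    have := hmem P
    rw [hL] at this
    exact xi_append_sub _ _ _ _ this
  have hm : (fun k => if k = i then some s else if k ∈ A then ψ P k else none) ∈ FIR P' q := by
    constructor
    · intro s'
      by_cases hss : s' = s
      · subst hss
        refine le_trans (card_le_card (t := insert i
          (univ.filter fun k => k ∈ A ∧ ψ P k = some s')) ?_) ?_
        · intro k hk
          simp only [mem_filter, mem_univ, true_and, mem_insert] at hk ⊢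
          by_cases hki : k = i
          · exact Or.inl hki
          · rw [if_neg hki] at hk
            by_cases hkA : k ∈ A
            · rw [if_pos hkA] at hk
              exact Or.inr ⟨hkA, hk⟩
            · rw [if_neg hkA] at hk
              cases hk
        · exact (card_insert_le _ _).trans hs
      · refine le_trans (card_le_card ?_) ((hIR P).1 s')
        intro k hk
        simp only [mem_filter, mem_univ, true_and] at hk ⊢
        by_cases hki : k = i
        · rw [if_pos hki] at hk
          exact absurd (Option.some.inj hk).symm hss
        · rw [if_neg hki] at hk
          by_cases hkA : k ∈ A
          · rwa [if_pos hkA] at hk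
          · rw [if_neg hkA] at hk
            cases hk
    · intro k
      by_cases hki : k = i
      · subst hki
        simp only [if_true, hP', Function.update_self]
        exact onlyPref_le _ _
      · simp only [if_neg hki]
        by_cases hkA : k ∈ A
        · simp only [if_pos hkA, hP', Function.update_of_ne hki]
          exact (hIR P).2 k
        · simp only [if_neg hkA]
          exact le_rfl
  have hmx := xi_transfer q A P P' (by
    intro k hk
    have hki : k ≠ i := fun e => hiA (e ▸ hk)
    rw [hP', Function.update_of_ne hki]) _ hν _ hm (by
    intro k hk
    have hki : k ≠ i := fun e => hiA (e ▸ hk)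
    simp [hki, hk])
  have h1 : ψ P' ∈ xiList P' q (A ++ [i]) := by
    have := hmem P'
    rw [hL, List.append_cons A i B] at this
    exact xi_append_sub _ _ _ _ this
  rw [xi_snoc, xiStep_mem] at h1
  have h2 := h1.2 ⟨_, hmx, by simp⟩
  have h3 := (hIR P').2 i
  rw [hP', Function.update_self, ← hP'] at h3
  have h4 : ψ P' i = some s := (onlyPref_ir _ _ _ h3).resolve_right h2
  have h5 := h i (onlyPref (u i) (some s))
  rwa [← hP', h4] at h5

lemma sdlike_unique (u : Prof I S) (q : S → ℕ) (L : List I)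
    (hcomp : ∀ i : I, i ∈ L) (hnd : L.Nodup) (ν ν' : Matching I S)
    (h : SDlike u q L ν) (h' : SDlike u q L ν') : ν = ν' := by
  have half : ∀ (ν ν' : Matching I S), SDlike u q L ν → SDlike u q L ν' →
      ∀ A i B, L = A ++ i :: B → (∀ k ∈ A, ν k = ν' k) →
        (u i).1 (ν' i) ≤ (u i).1 (ν i) := by
    intro ν ν' h h' A i B hL hA
    have hiA : i ∉ A := by
      intro hi
      rw [hL] at hnd
      exact (List.disjoint_of_nodup_append hnd) hi (by simp)
    cases hc : ν' i with
    | none => exact h.2.1 i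
    | some s =>
      apply h.2.2 A i B hL
      refine lt_of_lt_of_le (card_lt_card ?_) (h'.1 s)
      rw [Finset.ssubset_iff_of_subset]
      · exact ⟨i, by simp [hc], by simp [hiA]⟩
      · intro k hk
        simp only [mem_filter, mem_univ, true_and] at hk ⊢
        rw [← hA k hk.1]
        exact hk.2
  have main : ∀ A B, L = A ++ B → ∀ k ∈ A, ν k = ν' k := by
    intro A
    induction A using List.reverseRecOn with
    | nil => simp
    | append_singleton A i ih =>
      intro B hL k hk
      have hL' : L = A ++ i :: B := by rw [hL]; simp
      have hA := ih _ hL'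
      rcases List.mem_append.1 hk with hk | hk
      · exact hA k hk
      · rw [List.mem_singleton] at hk
        subst hk
        exact (u k).2 (le_antisymm
          (half ν' ν h' h A k B hL' (fun j hj => (hA j hj).symm))
          (half ν ν' h h' A k B hL' hA))
  funext i
  exact main L [] (by simp) i (hcomp i)

lemma sdlike_nw (u : Prof I S) (q : S → ℕ) (L : List I)
    (hcomp : ∀ i : I, i ∈ L) (ν : Matching I S) (h : SDlike u q L ν) (i : I) (s : S)
    (hs : (univ.filter fun j => ν j = some s).card < q s) :
    (u i).1 (some s) ≤ (u i).1 (ν i) := by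
  obtain ⟨A, B, hL⟩ := List.append_of_mem (hcomp i)
  apply h.2.2 A i B hL
  refine lt_of_le_of_lt (card_le_card ?_) hs
  intro k hk
  simp only [mem_filter, mem_univ, true_and] at hk ⊢
  exact hk.2

lemma msize_eq (μ : Matching I S) :
    msize μ = ∑ s, (univ.filter fun j => μ j = some s).card := by
  unfold msize
  rw [← card_biUnion]
  · congr 1
    ext i
    simp [Option.ne_none_iff_exists']
  · intro s _ st _ hss
    rw [Function.onFun, Finset.disjoint_left]
    intro j hj hjt
    simp only [mem_filter, mem_univ, true_and] at hj hjt
    rw [hj] at hjt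
    exact hss (Option.some.inj hjt)

/-- no EAM mechanism is size-wise dominated in equilibrium by
an individually rational mechanism (both admitting equilibria at every
profile). -/
theorem EAM_not_sizewise_dominated_in_equilibrium
    (q : S → ℕ) (L : List I) (hnd : L.Nodup) (hcomp : ∀ i : I, i ∈ L)
    (ψ φ : Mechanism I S) (hψ : IsEAMMech q L ψ) (hφ : IRMech q φ)
    (hψE : ∀ u : Prof I S, ∃ P', NashEq u ψ P')
    (hφE : ∀ u : Prof I S, ∃ P'', NashEq u φ P'') :
    ¬ ((∀ (u P' P'' : Prof I S), NashEq u ψ P' → NashEq u φ P'' →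
          msize (ψ P') ≤ msize (φ P'')) ∧
        ∃ u : Prof I S, ∀ P' P'' : Prof I S, NashEq u ψ P' →
          NashEq u φ P'' → msize (ψ P') < msize (φ P'')) := by
  rintro ⟨hdom, u, hstrict⟩
  obtain ⟨P₁, hP₁⟩ := hψE u
  obtain ⟨P₂, hP₂⟩ := hφE u
  have hlt := hstrict P₁ P₂ hP₁ hP₂
  have hν := nash_sdlike u q L hnd ψ hψ P₁ hP₁
  set ν := ψ P₁ with hνdef
  have hnw := sdlike_nw u q L hcomp ν hν
  -- a school with excess capacity
  obtain ⟨b, hb⟩ : ∃ b, (univ.filter fun j => ν j = some b).card < q b := by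
    by_contra hcon
    push Not at hcon
    rw [msize_eq, msize_eq] at hlt
    exact absurd hlt (not_lt.2 (sum_le_sum fun s _ => ((hφ P₂).1 s).trans (hcon s)))
  -- the truncated profile
  let T : I → Option S → ℕ := fun i x =>
    if x = none then 1 else if (u i).1 (ν i) ≤ (u i).1 x then 3 else 0
  let u₂ : Prof I S := fun i => tiered (u i) (T i)
  have hTn : ∀ i, T i none = 1 := fun i => by simp [T]
  have hTg : ∀ i s, (u i).1 (ν i) ≤ (u i).1 (some s) → T i (some s) = 3 :=
    fun i s h => by simp [T, h]
  have hTb : ∀ i s, ¬ (u i).1 (ν i) ≤ (u i).1 (some s) → T i (some s) = 0 :=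
    fun i s h => by simp [T, h]
  have hN₂ : NashEq u₂ ψ P₁ := by
    intro i Q
    have h := hP₁ i Q
    rw [← hνdef] at h ⊢
    generalize ψ (Function.update P₁ i Q) i = x at h
    simp only [u₂, tiered_le_iff]
    have hir := hν.2.1 i
    cases x with
    | none =>
      cases hc : ν i with
      | none => simp
      | some s => rw [hTn, hTg i s (by rw [hc])]; omega
    | some t =>
      by_cases ht : (u i).1 (ν i) ≤ (u i).1 (some t)
      · have := (u i).2 (le_antisymm ht h)
        rw [this]
        simp
      · rw [hTb i t ht]
        cases hc : ν i with
        | none => rw [hTn]; omega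
        | some s => rw [hTg i s (by rw [hc])]; omega
  obtain ⟨P₃, hP₃⟩ := hφE u₂
  have hμir := nash_ir u₂ q φ hφ P₃ hP₃
  have hμF := (hφ P₃).1
  have hge := hdom u₂ P₁ P₃ hN₂ hP₃
  rw [← hνdef] at hge
  have hN₃ := hP₃
  unfold NashEq at hN₃
  set μ := φ P₃ with hμdef
  have hgood : ∀ i s, μ i = some s → (u i).1 (ν i) ≤ (u i).1 (some s) := by
    intro i s h
    have := hμir i
    simp only [u₂, tiered_le_iff, h, hTn] at this
    by_contra hc
    rw [hTb i s hc] at this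
    omega
  have hle : msize μ ≤ msize ν := by
    rw [msize_eq, msize_eq]
    refine sum_le_sum fun s _ => ?_
    by_cases hs : (univ.filter fun j => ν j = some s).card < q s
    · apply card_le_card
      intro i hi
      simp only [mem_filter, mem_univ, true_and] at hi ⊢
      exact (u i).2 (le_antisymm (hgood i s hi) (hnw i s hs))
    · exact (hμF s).trans (not_lt.1 hs)
  -- everybody assigned under μ is assigned under ν
  have hsub : ∀ j, μ j ≠ none → ν j ≠ none := by
    intro j hμj hνj
    let Tj : Option S → ℕ := fun x => if x = some b then 2 else T j x
    let u₃ : Prof I S := Function.update u₂ j (tiered (u j) Tj)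
    have hbj := hnw j b hb
    have hbT : T j (some b) = 0 := by
      apply hTb
      intro hc
      have := (u j).2 (le_antisymm hc hbj)
      rw [hνj] at this
      cases this
    have hsd : SDlike u₃ q L (Function.update ν j (some b)) := by
      refine ⟨?_, ?_, ?_⟩
      · intro s
        by_cases hs : s = b
        · subst hs
          refine le_trans (card_le_card (t := insert j
            (univ.filter fun k => ν k = some s)) ?_) ((card_insert_le _ _).trans hb)
          intro k hk
          simp only [mem_filter, mem_univ, true_and, mem_insert] at hk ⊢
          by_cases hkj : k = j
          · exact Or.inl hkj
          · rw [Function.update_of_ne hkj] at hk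
            exact Or.inr hk
        · refine le_trans (card_le_card ?_) (hν.1 s)
          intro k hk
          simp only [mem_filter, mem_univ, true_and] at hk ⊢
          by_cases hkj : k = j
          · subst hkj
            rw [Function.update_self] at hk
            exact absurd (Option.some.inj hk).symm hs
          · rwa [Function.update_of_ne hkj] at hk
      · intro k
        by_cases hkj : k = j
        · subst hkj
          simp only [u₃, Function.update_self, tiered_le_iff]
          left
          simp [Tj, hTn]
        · simp only [u₃, Function.update_of_ne hkj, u₂, tiered_le_iff, hTn]
          cases hc : ν k with
          | none => simp [hTn]
          | some s => rw [hTg k s (by rw [hc])]; omega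
      · intro A i B hL s hs
        have hs' : (univ.filter fun k => k ∈ A ∧ ν k = some s).card < q s := by
          refine lt_of_le_of_lt (card_le_card ?_) hs
          intro k hk
          simp only [mem_filter, mem_univ, true_and] at hk ⊢
          have hkj : k ≠ j := by
            rintro rfl
            rw [hνj] at hk
            cases hk.2
          rw [Function.update_of_ne hkj]
          exact hk
        have h1 := hν.2.2 A i B hL s hs'
        by_cases hij : i = j
        · subst hij
          simp only [u₃, Function.update_self, tiered_le_iff]
          by_cases hsb : s = b
          · subst hsb
            simp
          · left
            have : T i (some s) = 0 := by
              apply hTb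
              intro hc
              have := (u i).2 (le_antisymm hc h1)
              rw [hνj] at this
              cases this
            simp [Tj, hsb, this]
        · simp only [u₃, Function.update_of_ne hij, u₂, tiered_le_iff]
          by_cases hc : (u i).1 (ν i) ≤ (u i).1 (some s)
          · have := (u i).2 (le_antisymm hc h1)
            rw [this]
            simp
          · rw [hTb i s hc]
            cases hc : ν i with
            | none => rw [hTn]; omega
            | some s => rw [hTg i s (by rw [hc])]; omega
    obtain ⟨P₄, hP₄⟩ := hψE u₃
    have h4 := sdlike_unique u₃ q L hcomp hnd _ _
      (nash_sdlike u₃ q L hnd ψ hψ P₄ hP₄) hsd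
    have hN : NashEq u₃ φ P₃ := by
      intro i Q
      have h := hN₃ i Q
      rw [← hμdef]
      by_cases hij : i = j
      · subst hij
        simp only [u₃, Function.update_self, u₂, tiered_le_iff] at h ⊢
        obtain ⟨t, ht⟩ := Option.ne_none_iff_exists'.1 hμj
        have hg := hTg i t (hgood i t ht)
        rw [ht] at h ⊢
        have htb : t ≠ b := by
          rintro rfl
          omega
        have h1 : Tj (some t) = 3 := by simp [Tj, htb, hg]
        generalize φ (Function.update P₃ i Q) i = x at h
        by_cases hx : x = some b
        · left
          rw [h1]
          simp [Tj, hx]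
        · have h2 : Tj x = T i x := by simp [Tj, hx]
          rw [h1, h2, ← hg]
          exact h
      · simpa only [u₃, Function.update_of_ne hij] using h
    have h5 := hdom u₃ P₄ P₃ hP₄ hN
    rw [h4, ← hμdef] at h5
    have h6 : msize ν < msize (Function.update ν j (some b)) := by
      unfold msize
      apply card_lt_card
      rw [Finset.ssubset_iff_of_subset]
      · exact ⟨j, by simp, by simp [hνj]⟩
      · intro k hk
        simp only [mem_filter, mem_univ, true_and] at hk ⊢
        by_cases hkj : k = j
        · subst hkj
          simp
        · rwa [Function.update_of_ne hkj]
    omega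
  have hsets : (univ.filter fun i => μ i ≠ none) = univ.filter fun i => ν i ≠ none := by
    apply eq_of_subset_of_card_le
    · intro k hk
      simp only [mem_filter, mem_univ, true_and] at hk ⊢
      exact hsub k hk
    · exact hge
  have hN : NashEq u φ P₃ := by
    intro i Q
    have h := hN₃ i Q
    rw [← hμdef]
    simp only [u₂, tiered_le_iff] at h
    have hir := hν.2.1 i
    generalize φ (Function.update P₃ i Q) i = x at h
    cases hc : μ i with
    | none =>
      have hνn : ν i = none := by
        by_contra hne
        have : i ∈ univ.filter fun i => μ i ≠ none := by
          rw [hsets]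
          simpa using hne
        simp [hc] at this
      rw [hc, hTn] at h
      cases x with
      | none => exact le_rfl
      | some s =>
        by_contra hcon
        rw [hTg i s (by rw [hνn]; omega)] at h
        omega
    | some t =>
      have hg := hgood i t hc
      rw [hc, hTg i t hg] at h
      cases x with
      | none => exact hir.trans hg
      | some s =>
        by_contra hcon
        rw [hTg i s (by omega)] at h
        omega
  have := hstrict P₁ P₃ hP₁ hN
  rw [← hνdef, ← hμdef] at this
  omega
end
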